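/- arXiv:1805.11336 — 3 statements merged into one kernel-verified Lean document; each statement's English description precedes it below -/
import Mathlib

section
/- Let V be a 4-dimensional vector space over k, let V′ be a 3-dimensional linear subspace of V, and let W′ be a 5-dimensional linear subspace of ⋀²V. If the image of ⋀²V′ in ⋀²V is contained in W′, then there exists a 2-dimensional linear subspace U of V′ such that W′ equals the span of all elements u ∧ v with u ∈ U and v ∈ V (i.e., W′ = U ∧ V). -/
open ExteriorAlgebra in
lemma aux_anti {k V : Type*} [Field k] [AddCommGroup V] [Module k V] (u v : V) :
    ι k v * ι k u = - (ι k u * ι k v) := by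
  have := ExteriorAlgebra.ι_add_mul_swap (R := k) v u
  exact eq_neg_of_add_eq_zero_left this

lemma aux_codim {k V : Type*} [Field k] [AddCommGroup V] [Module k V] [FiniteDimensional k V]
    (P Q : Submodule k V) (h : P ≤ Q) (hr : Module.finrank k Q = Module.finrank k P + 1) :
    ∃ w ∈ Q, ∀ x ∈ Q, ∃ u ∈ P, ∃ c : k, x = u + c • w := by
  have hne : P ≠ Q := by rintro rfl; omega
  obtain ⟨w, hwQ, hwP⟩ := SetLike.exists_of_lt (lt_of_le_of_ne h hne)
  have hle : P ⊔ Submodule.span k {w} ≤ Q :=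
    sup_le h ((Submodule.span_singleton_le_iff_mem _ _).2 hwQ)
  have hlt : P < P ⊔ Submodule.span k {w} := by
    refine lt_of_le_of_ne le_sup_left fun hh => hwP ?_
    rw [hh]
    exact Submodule.mem_sup_right (Submodule.mem_span_singleton_self w)
  have := Submodule.finrank_lt_finrank_of_lt hlt
  have heq := Submodule.eq_of_le_of_finrank_le hle (by omega)
  refine ⟨w, hwQ, fun x hx => ?_⟩
  rw [← heq] at hx
  obtain ⟨u, hu, y, hy, rfl⟩ := Submodule.mem_sup.1 hx
  obtain ⟨c, rfl⟩ := Submodule.mem_span_singleton.1 hy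
  exact ⟨u, hu, c, rfl⟩


/-- Let `V` be a 4-dimensional vector space over `k`, `V'` a 3-dimensional
subspace of `V`, and `W'` a 5-dimensional subspace of `⋀²V`. If the image of `⋀²V'` in
`⋀²V` is contained in `W'`, then there is a 2-dimensional subspace `U ⊆ V'` such that
`W'` is spanned by the elements `u ∧ v`, `u ∈ U`, `v ∈ V` (i.e. `W' = U ∧ V`). -/
theorem stmt_3 {k : Type*} [Field k] [IsAlgClosed k] [CharZero k]
    {V : Type*} [AddCommGroup V] [Module k V]
    (hV : Module.finrank k V = 4)
    (V' : Submodule k V) (hV' : Module.finrank k V' = 3)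
    (W' : Submodule k (ExteriorAlgebra k V))
    (hW'2 : W' ≤ ⋀[k]^2 V)
    (hW'rank : Module.finrank k W' = 5)
    (hincl : ∀ u ∈ V', ∀ v ∈ V', ExteriorAlgebra.ι k u * ExteriorAlgebra.ι k v ∈ W') :
    ∃ U : Submodule k V, U ≤ V' ∧ Module.finrank k U = 2 ∧
      W' = Submodule.span k
        {x | ∃ u ∈ U, ∃ v : V, x = ExteriorAlgebra.ι k u * ExteriorAlgebra.ι k v} := by

  classical
  have : FiniteDimensional k V := FiniteDimensional.of_finrank_pos (by omega)
  obtain ⟨e, -, he⟩ := aux_codim V' ⊤ le_top (by rw [finrank_top]; omega)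
  let m : V →ₗ[k] ExteriorAlgebra k V :=
    (LinearMap.mulRight k (ExteriorAlgebra.ι k e)) ∘ₗ ExteriorAlgebra.ι k
  have hm : ∀ v, m v = ExteriorAlgebra.ι k v * ExteriorAlgebra.ι k e := fun v => rfl
  let b := Module.finBasisOfFinrankEq k V' hV'
  let i : V →ₗ[k] ExteriorAlgebra k V := ExteriorAlgebra.ι k
  let S : Finset (ExteriorAlgebra k V) :=
    {i (b 0) * i (b 1), i (b 0) * i (b 2), i (b 1) * i (b 2)}
  let A : Submodule k (ExteriorAlgebra k V) := Submodule.span k (S : Set (ExteriorAlgebra k V))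
  have hA3 : Module.finrank k A ≤ 3 := (finrank_span_finset_le_card S).trans Finset.card_le_three
  have : FiniteDimensional k A := FiniteDimensional.span_finset k S
  have hAmem : ∀ u ∈ V', ∀ v ∈ V', i u * i v ∈ A := by
    intro u hu v hv
    have e1 : i (b 0) * i (b 1) ∈ A := Submodule.subset_span (by simp [S])
    have e2 : i (b 0) * i (b 2) ∈ A := Submodule.subset_span (by simp [S])
    have e3 : i (b 1) * i (b 2) ∈ A := Submodule.subset_span (by simp [S])
    have hs : ∀ x ∈ V', ∃ c : Fin 3 → k, x = c 0 • (b 0 : V) + c 1 • (b 1 : V) + c 2 • (b 2 : V) := by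
      intro x hx
      refine ⟨b.repr ⟨x, hx⟩, ?_⟩
      have := congrArg Subtype.val (b.sum_repr ⟨x, hx⟩)
      rw [Fin.sum_univ_three] at this
      exact this.symm
    obtain ⟨c, rfl⟩ := hs u hu
    obtain ⟨d, rfl⟩ := hs v hv
    have key : i (c 0 • (b 0 : V) + c 1 • (b 1 : V) + c 2 • (b 2 : V)) *
        i (d 0 • (b 0 : V) + d 1 • (b 1 : V) + d 2 • (b 2 : V)) =
        (c 0 * d 1 - c 1 * d 0) • (i (b 0) * i (b 1)) +
        (c 0 * d 2 - c 2 * d 0) • (i (b 0) * i (b 2)) +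
        (c 1 * d 2 - c 2 * d 1) • (i (b 1) * i (b 2)) := by
      have a1 : i (b 1) * i (b 0) = - (i (b 0) * i (b 1)) := aux_anti _ _
      have a2 : i (b 2) * i (b 0) = - (i (b 0) * i (b 2)) := aux_anti _ _
      have a3 : i (b 2) * i (b 1) = - (i (b 1) * i (b 2)) := aux_anti _ _
      have s : ∀ x, i x * i x = 0 := ExteriorAlgebra.ι_sq_zero
      simp only [map_add, map_smul, mul_add, add_mul, smul_mul_assoc, mul_smul_comm, a1, a2, a3, s]
      module
    rw [key]
    exact A.add_mem (A.add_mem (A.smul_mem _ e1) (A.smul_mem _ e2)) (A.smul_mem _ e3)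
  have hAW : A ≤ W' := by
    refine Submodule.span_le.2 fun x hx => ?_
    simp only [S, Finset.coe_insert, Finset.coe_singleton, Set.mem_insert_iff,
      Set.mem_singleton_iff] at hx
    rcases hx with rfl | rfl | rfl <;> exact hincl _ (b _).2 _ (b _).2
  have hdec : ⋀[k]^2 V ≤ A ⊔ V'.map m := by
    change (LinearMap.range (ExteriorAlgebra.ι k : V →ₗ[k] _)) ^ 2 ≤ _
    rw [pow_two, Submodule.mul_le]
    rintro _ ⟨x, rfl⟩ _ ⟨y, rfl⟩
    obtain ⟨a, ha, s, rfl⟩ := he x trivial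
    obtain ⟨c, hc, t, rfl⟩ := he y trivial
    have key : i (a + s • e) * i (c + t • e) = i a * i c + m (t • a - s • c) := by
      have a1 : i e * i c = - (i c * i e) := aux_anti _ _
      have s : i e * i e = 0 := ExteriorAlgebra.ι_sq_zero e
      have hm' : ∀ v, m v = i v * i e := hm
      simp only [hm', map_add, map_sub, map_smul, mul_add, add_mul, sub_mul, smul_mul_assoc,
        mul_smul_comm, a1, s]
      module
    change i (a + s • e) * i (c + t • e) ∈ _
    rw [key]
    exact Submodule.add_mem_sup (hAmem _ ha _ hc) (Submodule.mem_map_of_mem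
      (V'.sub_mem (V'.smul_mem _ ha) (V'.smul_mem _ hc)))
  let U : Submodule k V := V' ⊓ W'.comap m
  have hUV : U ≤ V' := inf_le_left
  have hWle : W' ≤ A ⊔ U.map m := by
    intro x hx
    obtain ⟨a, ha, _, ⟨u, hu, rfl⟩, rfl⟩ := Submodule.mem_sup.1 (hdec (hW'2 hx))
    refine Submodule.add_mem_sup ha (Submodule.mem_map_of_mem ⟨hu, ?_⟩)
    have := W'.sub_mem hx (hAW ha)
    simpa using this
  have hUlow : 2 ≤ Module.finrank k U := by
    have h1 := Submodule.finrank_mono hWle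
    have h2 := Submodule.finrank_add_le_finrank_add_finrank A (U.map m)
    have h3 := Submodule.finrank_map_le m U
    omega
  have hUhigh : Module.finrank k U ≠ 3 := by
    intro h
    have hU : U = V' := Submodule.eq_of_le_of_finrank_le hUV (by omega)
    have hle : ⋀[k]^2 V ≤ W' := by
      refine hdec.trans (sup_le hAW ?_)
      rw [← hU]
      exact Submodule.map_le_iff_le_comap.2 inf_le_right
    have heq := le_antisymm hle hW'2
    have h6 := exteriorPower.finrank_eq k 2 (M := V)
    rw [hV, heq, hW'rank] at h6
    exact absurd h6 (by decide)
  have hUle := Submodule.finrank_mono hUV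
  have hU2 : Module.finrank k U = 2 := by omega
  refine ⟨U, hUV, hU2, ?_⟩
  obtain ⟨w, hw, hwU⟩ := aux_codim U V' hUV (by omega)
  apply le_antisymm
  · refine hWle.trans (sup_le (Submodule.span_le.2 ?_) ?_)
    · have hb : ∀ x ∈ V', ∀ y ∈ V', i x * i y ∈ Submodule.span k
        {x | ∃ u ∈ U, ∃ v : V, x = ExteriorAlgebra.ι k u * ExteriorAlgebra.ι k v} := by
        intro x hx y hy
        obtain ⟨u, hu, s, rfl⟩ := hwU x hx
        obtain ⟨u', hu', t, rfl⟩ := hwU y hy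
        have key : i (u + s • w) * i (u' + t • w) = i u * i (u' + t • w) - i u' * i (s • w) := by
          have a1 : i w * i u' = - (i u' * i w) := aux_anti _ _
          have s : i w * i w = 0 := ExteriorAlgebra.ι_sq_zero w
          simp only [map_add, map_smul, mul_add, add_mul, smul_mul_assoc, mul_smul_comm, a1, s]
          module
        rw [key]
        exact Submodule.sub_mem _ (Submodule.subset_span ⟨_, hu, _, rfl⟩)
          (Submodule.subset_span ⟨_, hu', _, rfl⟩)
      intro x hx
      simp only [S, Finset.coe_insert, Finset.coe_singleton, Set.mem_insert_iff,
        Set.mem_singleton_iff] at hx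
      rcases hx with rfl | rfl | rfl <;> exact hb _ (b _).2 _ (b _).2
    · rintro _ ⟨u, hu, rfl⟩
      exact Submodule.subset_span ⟨u, hu, e, rfl⟩
  · refine Submodule.span_le.2 ?_
    rintro _ ⟨u, hu, v, rfl⟩
    obtain ⟨a, ha, t, rfl⟩ := he v trivial
    rw [map_add, map_smul, mul_add, mul_smul_comm]
    exact W'.add_mem (hincl _ (hUV hu) _ ha) (W'.smul_mem _ hu.2)
end

section
/- Let P₀,…,P₄ be five distinct points of ℙ³(k) such that no four of them lie in a plane (i.e., any four of the representing vectors in k⁴ are linearly independent), and let Γ = {P₀,…,P₄}. Then the twisted ideal sheaf I_Γ(2) is globally generated; in ideal-theoretic terms, the homogeneous vanishing ideal I(Γ) ⊆ k[x₀,…,x₃] of Γ is generated by its degree-2 homogeneous component I(Γ)₂ (by quadratic forms). -/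
open MvPolynomial

theorem aux_forms {k : Type*} [Field k] (P : Fin 5 → (Fin 4 → k))
    (hplane : ∀ f : Fin 4 → Fin 5, Function.Injective f →
      LinearIndependent k (fun i => P (f i))) :
    ∃ M : Fin 4 → MvPolynomial (Fin 4) k, (∀ i, (M i).IsHomogeneous 1) ∧
      (∀ j, X j ∈ Submodule.span k (Set.range M)) ∧
      (∀ i, eval (P (Fin.last 4)) (M i) = 1) ∧
      (∀ i, eval (P i.castSucc) (M i) ≠ 0) ∧
      (∀ i j, i ≠ j → eval (P j.castSucc) (M i) = 0) := by
  have hli := hplane Fin.castSucc (Fin.castSucc_injective 4)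
  let b := basisOfLinearIndependentOfCardEqFinrank hli (by simp)
  have hb : ∀ i, b i = P i.castSucc := fun i => by simp [b]
  let a : Fin 4 → k := fun i => b.repr (P (Fin.last 4)) i
  have ha : ∀ i, a i ≠ 0 := by
    intro i hi
    have hinj : Function.Injective (Function.update (Fin.castSucc : Fin 4 → Fin 5) i (Fin.last 4)) := by
      intro x y hxy
      by_cases hx : x = i <;> by_cases hy : y = i
      · rw [hx, hy]
      · subst hx
        simp only [Function.update_self, Function.update_of_ne hy] at hxy
        exact absurd hxy.symm (Fin.castSucc_lt_last y).ne
      · subst hy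
        simp only [Function.update_self, Function.update_of_ne hx] at hxy
        exact absurd hxy (Fin.castSucc_lt_last x).ne
      · simp only [Function.update_of_ne hx, Function.update_of_ne hy] at hxy
        exact Fin.castSucc_injective 4 hxy
    have h1 := Fintype.linearIndependent_iff.1 (hplane _ hinj) (Function.update a i (-1)) (by
      have h2 := b.sum_repr (P (Fin.last 4))
      rw [← Finset.add_sum_erase _ _ (Finset.mem_univ i)] at h2 ⊢
      have h3 : b.repr (P (Fin.last 4)) i = 0 := hi
      rw [h3, zero_smul, zero_add] at h2
      simp only [Function.update_self]
      rw [neg_one_smul, neg_add_eq_zero]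
      rw [← h2]
      refine Finset.sum_congr rfl fun x hx => ?_
      have hx := Finset.ne_of_mem_erase hx
      rw [Function.update_of_ne hx, Function.update_of_ne hx, hb]) i
    simp at h1
  let L : Fin 4 → MvPolynomial (Fin 4) k :=
    fun i => ∑ j, C (b.repr (Pi.single j 1) i) * X j
  have hL : ∀ i v, eval v (L i) = b.repr v i := by
    intro i v
    have : v = ∑ j, v j • (Pi.single j 1 : Fin 4 → k) := pi_eq_sum_univ' v
    conv_rhs => rw [this]
    simp [L, mul_comm]
  refine ⟨fun i => C (a i)⁻¹ * L i, ?_, ?_, ?_, ?_, ?_⟩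
  · intro i
    refine (IsHomogeneous.sum _ _ _ fun j _ => ?_).C_mul _
    exact (isHomogeneous_X k j).C_mul _
  · intro j
    have : (X j : MvPolynomial (Fin 4) k)
        = ∑ i, (P i.castSucc j * a i) • (C (a i)⁻¹ * L i) := by
      have h1 : ∀ i, (P i.castSucc j * a i) • (C (a i)⁻¹ * L i) = C (P i.castSucc j) * L i := by
        intro i
        rw [smul_eq_C_mul, ← mul_assoc, ← C_mul, mul_assoc, mul_inv_cancel₀ (ha i), mul_one]
      simp only [h1]
      simp only [L, Finset.mul_sum]
      rw [Finset.sum_comm]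
      have h2 : ∀ l : Fin 4, ∑ i, C (P i.castSucc j) * (C (b.repr (Pi.single l 1) i) * X l)
          = C ((Pi.single l 1 : Fin 4 → k) j) * (X l : MvPolynomial (Fin 4) k) := by
        intro l
        have h3 := congrFun (b.sum_repr (Pi.single l 1)) j
        rw [← h3]
        simp only [← mul_assoc, ← C_mul, ← Finset.sum_mul, ← map_sum]
        simp [hb, mul_comm]
      simp only [h2]
      rw [Finset.sum_eq_single j]
      · simp
      · intro l _ hl
        simp [Pi.single_eq_of_ne hl.symm]
      · simp
    rw [this]
    exact Submodule.sum_mem _ fun i _ => Submodule.smul_mem _ _ (Submodule.subset_span ⟨i, rfl⟩)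
  · intro i
    simp only [map_mul, eval_C, hL]
    exact inv_mul_cancel₀ (ha i)
  · intro i
    simp only [map_mul, eval_C, hL, ← hb]
    simpa using ha i
  · intro i j hij
    simp only [map_mul, eval_C, hL, ← hb]
    simp [hij.symm]

theorem aux_ring {R : Type*} [CommRing R] (m : Fin 4 → R)
    (h : ∀ i j, i ≠ j → m i * m j = m 0 * m 1) (n : ℕ) (i : Fin 4) :
    m 0 * m 1 * m i ^ n = m 0 * m 1 * m 0 ^ n := by
  have h1 : m 0 * m 1 * m i = m 0 * m 1 * m 0 := by
    by_cases hi : i = 0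
    · rw [hi]
    · obtain ⟨j, hj0, hji⟩ : ∃ j : Fin 4, j ≠ 0 ∧ j ≠ i := by
        revert i; decide
      rw [← h 0 j hj0.symm, mul_assoc, h j i hji, h 0 j hj0.symm]
      ring
  induction n with
  | zero => simp
  | succ n ih =>
    rw [pow_succ, ← mul_assoc, ih, pow_succ, mul_right_comm, h1]; ring

theorem aux_span {k : Type*} [Field k] (M : Fin 4 → MvPolynomial (Fin 4) k)
    (hX : ∀ j, X j ∈ Submodule.span k (Set.range M))
    (J : Ideal (MvPolynomial (Fin 4) k))
    (hJ : ∀ i j, i ≠ j → M i * M j - M 0 * M 1 ∈ J) (n : ℕ) :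
    homogeneousSubmodule (Fin 4) k (n + 2) ≤
      J.restrictScalars k ⊔ (Submodule.span k (Set.range fun i => M i ^ (n + 2)) ⊔
        Submodule.span k {M 0 * M 1 * M 0 ^ n}) := by
  set W : ℕ → Submodule k (MvPolynomial (Fin 4) k) := fun n => 
    J.restrictScalars k ⊔ (Submodule.span k (Set.range fun i => M i ^ (n + 2)) ⊔
        Submodule.span k {M 0 * M 1 * M 0 ^ n}) with hW
  have hWJ : ∀ n f, f ∈ J → f ∈ W n := fun n f hf => Submodule.mem_sup_left hf
  have hWM : ∀ n i, M i ^ (n + 2) ∈ W n := fun n i =>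
    Submodule.mem_sup_right (Submodule.mem_sup_left (Submodule.subset_span ⟨i, rfl⟩))
  have hWq : ∀ n, M 0 * M 1 * M 0 ^ n ∈ W n := fun n =>
    Submodule.mem_sup_right (Submodule.mem_sup_right (Submodule.mem_span_singleton_self _))
  have hcong : ∀ n f g, g ∈ W n → f - g ∈ J → f ∈ W n := fun n f g hg hfg => by
    have := (W n).add_mem (hWJ n _ hfg) hg
    simpa using this
  have hm : ∀ i j, i ≠ j → Ideal.Quotient.mk J (M i) * Ideal.Quotient.mk J (M j)
      = Ideal.Quotient.mk J (M 0) * Ideal.Quotient.mk J (M 1) := by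
    intro i j hij
    rw [← map_mul, ← map_mul]
    exact Ideal.Quotient.eq.2 (hJ i j hij)
  have hr := aux_ring (fun i => Ideal.Quotient.mk J (M i)) hm
  have h1 : homogeneousSubmodule (Fin 4) k 1 ≤ Submodule.span k (Set.range M) := by
    rw [homogeneousSubmodule_one_eq_span_X, Submodule.span_le]
    rintro _ ⟨j, rfl⟩
    exact hX j
  have key : ∀ n, Submodule.span k (Set.range M) ^ (n + 2) ≤ W n := by
    intro n
    induction n with
    | zero =>
      rw [zero_add, pow_two, Submodule.span_mul_span, Submodule.span_le]
      rintro _ ⟨_, ⟨i, rfl⟩, _, ⟨j, rfl⟩, rfl⟩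
      by_cases hij : i = j
      · subst hij
        have := hWM 0 i
        simpa [pow_two] using this
      · refine hcong 0 _ _ (hWq 0) ?_
        simpa using hJ i j hij
    | succ n ih =>
      rw [pow_succ]
      refine (mul_le_mul' ih le_rfl).trans ?_
      rw [Submodule.mul_le]
      intro f hf g hg
      have hmul : ∀ j, W n ≤ (W (n+1)).comap (LinearMap.mulRight k (M j)) := by
        intro j
        refine sup_le ?_ (sup_le ?_ ?_)
        · intro f hf
          rw [Submodule.mem_comap, LinearMap.mulRight_apply]
          exact hWJ _ _ (J.mul_mem_right _ hf)
        · rw [Submodule.span_le]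
          rintro _ ⟨i, rfl⟩
          rw [SetLike.mem_coe, Submodule.mem_comap, LinearMap.mulRight_apply]
          by_cases hij : i = j
          · subst hij
            rw [← pow_succ]
            exact hWM (n+1) i
          · refine hcong _ _ _ (hWq (n+1)) ?_
            rw [← Ideal.Quotient.eq]
            simp only [map_mul, map_pow]
            rw [← hr (n+1) i, ← hm i j hij]
            ring
        · rw [Submodule.span_singleton_le_iff_mem, Submodule.mem_comap, LinearMap.mulRight_apply]
          refine hcong _ _ _ (hWq (n+1)) ?_
          rw [← Ideal.Quotient.eq]
          simp only [map_mul, map_pow]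
          have := hr 1 j
          simp only [pow_one] at this
          rw [mul_right_comm, this]
          ring
      induction hg using Submodule.span_induction with
      | mem x hx =>
        obtain ⟨j, rfl⟩ := hx
        have h3 := hmul j hf
        rwa [Submodule.mem_comap, LinearMap.mulRight_apply] at h3
      | zero => simp
      | add x y _ _ hx hy => rw [mul_add]; exact add_mem hx hy
      | smul c x _ hx => rw [mul_smul_comm]; exact Submodule.smul_mem _ _ hx
  rw [← homogeneousSubmodule_one_pow]
  exact (pow_le_pow_left' h1 _).trans (key n)


/-- Let `P₀,…,P₄` be five distinct points of `ℙ³(k)` (given by nonzero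
representing vectors of `k⁴`) such that no four of them lie in a plane (any four of the
representing vectors are linearly independent), and let `Γ = {P₀,…,P₄}`.  Then the
homogeneous vanishing ideal `I(Γ)` — the ideal generated by all homogeneous polynomials
vanishing at the five points — is generated by its quadratic part, i.e. by the quadratic
forms vanishing at the five points (so `I_Γ(2)` is globally generated). -/
theorem stmt_7 {k : Type*} [Field k] [IsAlgClosed k] [CharZero k]
    (P : Fin 5 → (Fin 4 → k)) (hP0 : ∀ i, P i ≠ 0)
    (hPdist : ∀ i j, i ≠ j → ∀ c : k, P i ≠ c • P j)
    (hplane : ∀ f : Fin 4 → Fin 5, Function.Injective f →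
      LinearIndependent k (fun i => P (f i))) :
    Ideal.span {f : MvPolynomial (Fin 4) k |
        (∃ d, f.IsHomogeneous d) ∧ ∀ i, MvPolynomial.eval (P i) f = 0} =
      Ideal.span {f : MvPolynomial (Fin 4) k |
        f.IsHomogeneous 2 ∧ ∀ i, MvPolynomial.eval (P i) f = 0} := by
  apply le_antisymm
  swap
  · exact Ideal.span_mono fun f hf => ⟨⟨2, hf.1⟩, hf.2⟩
  rw [Ideal.span_le]
  rintro f ⟨⟨d, hd⟩, hf⟩
  obtain ⟨M, hM1, hX, hlast, hne, hz⟩ := aux_forms P hplane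
  set J := Ideal.span {f : MvPolynomial (Fin 4) k |
        f.IsHomogeneous 2 ∧ ∀ i, MvPolynomial.eval (P i) f = 0} with hJdef
  have hq : ∀ i j l, i ≠ j → eval (P (Fin.castSucc l)) (M i * M j) = 0 := by
    intro i j l hij
    rw [map_mul]
    by_cases h : i = l
    · rw [hz j l (h ▸ hij.symm), mul_zero]
    · rw [hz i l h, zero_mul]
  have hJ : ∀ i j, i ≠ j → M i * M j - M 0 * M 1 ∈ J := by
    intro i j hij
    refine Ideal.subset_span ⟨((hM1 i).mul (hM1 j)).sub ((hM1 0).mul (hM1 1)), fun l => ?_⟩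
    refine Fin.lastCases ?_ (fun l => ?_) l
    · simp only [map_sub, map_mul, hlast, sub_self]
    · rw [map_sub, hq i j l hij, hq 0 1 l (by decide), sub_zero]
  have hJ0 : ∀ g ∈ J, ∀ i, eval (P i) g = 0 := by
    intro g hg i
    have : J ≤ RingHom.ker (eval (P i)) := by
      rw [hJdef, Ideal.span_le]
      intro h hh
      exact hh.2 i
    exact this hg
  have hdiag : ∀ (c : Fin 4 → k) (n : ℕ) (l : Fin 4),
      eval (P l.castSucc) (∑ i, c i • M i ^ (n + 1)) = c l * eval (P l.castSucc) (M l) ^ (n + 1) := by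
    intro c n l
    rw [map_sum, Finset.sum_eq_single l]
    · simp [smul_eval]
    · intro i _ hi
      simp [smul_eval, hz i l hi]
    · simp
  match d, hd with
  | 0, hd =>
    have h0 : f = C (coeff 0 f) := by
      rw [← totalDegree_eq_zero_iff_eq_C]
      exact Nat.le_zero.1 hd.totalDegree_le
    have := hf 0
    rw [h0, eval_C] at this
    rw [h0, this, C_0]
    exact J.zero_mem
  | 1, hd =>
    have h1 : f ∈ Submodule.span k (Set.range M) := by
      have h2 : homogeneousSubmodule (Fin 4) k 1 ≤ Submodule.span k (Set.range M) := by
        rw [homogeneousSubmodule_one_eq_span_X, Submodule.span_le]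
        rintro _ ⟨j, rfl⟩
        exact hX j
      exact h2 hd
    obtain ⟨c, rfl⟩ := (Submodule.mem_span_range_iff_exists_fun k).1 h1
    have hc : ∀ l, c l = 0 := by
      intro l
      have h2 := hdiag c 0 l
      simp only [zero_add, pow_one] at h2
      rw [hf] at h2
      exact (mul_eq_zero.1 h2.symm).resolve_right (hne l)
    simp [hc]
  | n + 2, hd =>
    have h1 := aux_span M hX J hJ n hd
    obtain ⟨g, hg, r, hr, rfl⟩ := Submodule.mem_sup.1 h1
    obtain ⟨s, hs, t, ht, rfl⟩ := Submodule.mem_sup.1 hr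
    obtain ⟨c, rfl⟩ := (Submodule.mem_span_range_iff_exists_fun k).1 hs
    obtain ⟨e, rfl⟩ := Submodule.mem_span_singleton.1 ht
    have hg' : g ∈ J := hg
    have hc : ∀ l, c l = 0 := by
      intro l
      have h2 := hf l.castSucc
      rw [map_add, map_add, hJ0 g hg', hdiag c (n + 1) l, smul_eval, map_mul,
        hq 0 1 l (by decide), zero_mul, mul_zero, add_zero, zero_add] at h2
      exact (mul_eq_zero.1 h2).resolve_right (pow_ne_zero _ (hne l))
    have he : e = 0 := by
      have h2 := hf (Fin.last 4)
      rw [map_add, map_add, hJ0 g hg'] at h2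
      simp only [smul_eval, map_mul, map_pow, hlast, hc, zero_smul, Finset.sum_const_zero, map_zero] at h2
      simpa using h2
    simpa [hc, he] using hg'
end

section
/- Let 𝒜 be an abelian category with enough injective objects, let K(𝒜) denote the homotopy category of cochain complexes in 𝒜 and D(𝒜) the derived category of 𝒜. Let X• be a cochain complex in 𝒜 which is bounded to the right (X^n = 0 for all sufficiently large n) and Y• a cochain complex bounded to the left (Y^n = 0 for all sufficiently small n). Then the canonical map Hom_{K(𝒜)}(X•, Y•) → Hom_{D(𝒜)}(X•, Y•) is: (i) surjective if Ext^{p−q}_{𝒜}(X^p, Y^q) = 0 for all p > q; (ii) injective if Ext^{p−q−1}_{𝒜}(X^p, Y^q) = 0 for all p > q + 1. -/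
open CategoryTheory CategoryTheory.Limits

universe w v u

namespace Stmt10Aux

open CochainComplex CochainComplex.HomComplex Abelian Pretriangulated

variable {𝒜 : Type u} [Category.{v} 𝒜] [Abelian 𝒜]

/-- Short exact sequences `0 → Zⁿ → Cⁿ → Zⁿ⁺¹ → 0` of an acyclic complex. -/
lemma cycles_shortExact (C : CochainComplex 𝒜 ℤ) (n m : ℤ) (h : n + 1 = m) (hC : C.ExactAt m) :
    (ShortComplex.mk (C.iCycles n) (C.toCycles n m) (by
      rw [← cancel_mono (C.iCycles m)]; simp)).ShortExact := by
  have hepi : Epi (C.toCycles n m) :=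
    Preadditive.epi_of_isZero_cokernel' _
      (C.homologyIsCokernel n m (by simp; omega)) hC.isZero_homology
  refine { exact := ?_, mono_f := by dsimp; infer_instance, epi_g := hepi }
  apply ShortComplex.exact_of_f_is_kernel
  refine KernelFork.IsLimit.ofι' _ _ (fun {A} k hk => ⟨C.liftCycles k m (by simp [h]) (by
    have := hk =≫ C.iCycles m
    simpa using this), by simp⟩)

/-- `Ext` vanishing for cycles of an acyclic bounded below complex. -/
lemma ext_cycles_subsingleton [HasExt.{w} 𝒜] (C : CochainComplex 𝒜 ℤ) (hC : C.Acyclic)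
    (b : ℤ) (hb : ∀ n, n ≤ b → IsZero (C.X n)) (A : 𝒜) (p : ℤ)
    (hA : ∀ k : ℕ, 1 ≤ k → Subsingleton (Ext.{w} A (C.X (p - 1 - k)) k)) (N : ℕ) :
    ∀ k : ℕ, 1 ≤ k → p - k ≤ b + N → Subsingleton (Ext.{w} A (C.cycles (p - k)) k) := by
  induction N with
  | zero =>
    intro k _ hk
    have hz : IsZero (C.cycles (p - k)) :=
      IsZero.of_mono (C.iCycles (p - k)) (hb _ (by simpa using hk))
    refine subsingleton_of_forall_eq 0 (fun x => ?_)
    rw [← Ext.comp_mk₀_id x, hz.eq_of_src (𝟙 _) 0, Ext.mk₀_zero, Ext.comp_zero]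
  | succ N ih =>
    intro k hk1 hk
    refine subsingleton_of_forall_eq 0 (fun x => ?_)
    have hS := cycles_shortExact C (p - (k + 1 : ℕ)) (p - k) (by push_cast; ring) (hC _)
    have h1 := ih (k + 1) (by omega) (by push_cast at hk ⊢; omega)
    have h2 := hA k hk1
    rw [show p - 1 - (k : ℤ) = p - (k + 1 : ℕ) by push_cast; ring] at h2
    obtain ⟨y, rfl⟩ := Ext.covariant_sequence_exact₃ A hS x rfl (Subsingleton.elim _ _)
    have : y = 0 := Subsingleton.elim _ _
    rw [this, Ext.zero_comp]

/-- Lifting of cocycles. -/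
lemma lift_cocycle [HasExt.{w} 𝒜] (C : CochainComplex 𝒜 ℤ) (hC : C.Acyclic)
    (b : ℤ) (hb : ∀ n, n ≤ b → IsZero (C.X n)) (A : 𝒜) (p : ℤ)
    (hA : ∀ k : ℕ, 1 ≤ k → Subsingleton (Ext.{w} A (C.X (p - 1 - k)) k))
    (φ : A ⟶ C.X p) (hφ : φ ≫ C.d p (p + 1) = 0) :
    ∃ ψ : A ⟶ C.X (p - 1), ψ ≫ C.d (p - 1) p = φ := by
  have h1 := ext_cycles_subsingleton C hC b hb A p hA (p - 1 - b).toNat 1 le_rfl (by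
    push_cast; omega)
  have hS := cycles_shortExact C (p - (1 : ℕ)) p (by push_cast; ring) (hC _)
  let x := C.liftCycles φ (p + 1) (by simp) hφ
  obtain ⟨y, hy⟩ := Ext.covariant_sequence_exact₃ A hS (Ext.mk₀ x) (zero_add 1)
    (Subsingleton.elim _ _)
  obtain ⟨ψ, rfl⟩ := (Ext.mk₀_bijective _ _).2 y
  rw [Ext.mk₀_comp_mk₀] at hy
  have hy := (Ext.mk₀_bijective _ _).1 hy
  refine ⟨ψ, ?_⟩
  have := hy =≫ C.iCycles p
  simpa [x] using this

/-- One step of the descending construction of a null-homotopy. -/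
lemma step (X C : CochainComplex 𝒜 ℤ) (f : X ⟶ C)
    (hlift : ∀ p (φ : X.X p ⟶ C.X p), φ ≫ C.d p (p + 1) = 0 →
      ∃ ψ : X.X p ⟶ C.X (p - 1), ψ ≫ C.d (p - 1) p = φ)
    (α : Cochain X C (-1)) (m : ℤ)
    (hα : ∀ p, m < p → (δ (-1) 0 α).v p p (add_zero p) = f.f p) :
    ∃ α' : Cochain X C (-1),
      (∀ p, m ≤ p → (δ (-1) 0 α').v p p (add_zero p) = f.f p) ∧
      ∀ p q (hpq : p + -1 = q), m < p → α'.v p q hpq = α.v p q hpq := by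
  have hδ (β : Cochain X C (-1)) (p : ℤ) : (δ (-1) 0 β).v p p (add_zero p) =
      β.v p (p - 1) (by omega) ≫ C.d (p - 1) p +
        X.d p (p + 1) ≫ β.v (p + 1) p (by omega) := by
    rw [δ_v (-1) 0 (neg_add_cancel 1) β p p (add_zero _) (p - 1) (p + 1) (by omega) (by omega)]
    simp
  let u := f.f m - (δ (-1) 0 α).v m m (add_zero m)
  have hu : u ≫ C.d m (m + 1) = 0 := by
    have eq := hα (m + 1) (by omega)
    rw [δ_v (-1) 0 (neg_add_cancel 1) α (m + 1) (m + 1) (add_zero _) m (m + 2)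
      (by omega) (by omega)] at eq
    simp only [Int.negOnePow_zero, one_smul] at eq
    simp only [u, hδ, Preadditive.sub_comp, f.comm, ← eq, Preadditive.comp_add,
      HomologicalComplex.d_comp_d_assoc, zero_comp, Preadditive.add_comp, Category.assoc,
      C.d_comp_d, comp_zero, zero_add, add_zero, sub_self]
  obtain ⟨ψ, hψ⟩ := hlift m u hu
  have hne : ∀ p q (hpq : p + -1 = q), m < p →
      (α + Cochain.single ψ (-1)).v p q hpq = α.v p q hpq := by
    intro p q hpq hp
    rw [Cochain.add_v, Cochain.single_v_eq_zero _ _ _ _ _ (by omega), add_zero]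
  refine ⟨α + Cochain.single ψ (-1), ?_, hne⟩
  intro p hp
  obtain hp | rfl := hp.lt_or_eq
  · rw [← hα p hp, hδ, hδ, hne _ _ _ hp, hne _ _ _ (by omega)]
  · rw [hδ, hne (m + 1) m _ (by omega), Cochain.add_v, Cochain.single_v, Preadditive.add_comp, hψ]
    simp only [u, hδ]
    abel

/-- The null-homotopy. -/
lemma nullhomotopic (X C : CochainComplex 𝒜 ℤ) (f : X ⟶ C) (a : ℤ)
    (ha : ∀ n, a ≤ n → IsZero (X.X n))
    (hlift : ∀ p (φ : X.X p ⟶ C.X p), φ ≫ C.d p (p + 1) = 0 →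
      ∃ ψ : X.X p ⟶ C.X (p - 1), ψ ≫ C.d (p - 1) p = φ) :
    Nonempty (Homotopy f 0) := by
  let S (n : ℕ) : Type _ := {α : Cochain X C (-1) //
    ∀ p, a - n - 1 < p → (δ (-1) 0 α).v p p (add_zero p) = f.f p}
  have hstep (n : ℕ) (x : S n) : ∃ y : S (n + 1),
      ∀ p q (hpq : p + -1 = q), a - n - 1 < p → y.1.v p q hpq = x.1.v p q hpq := by
    obtain ⟨β, h1, h2⟩ := step X C f hlift x.1 (a - n - 1) x.2
    exact ⟨⟨β, fun p hp => h1 p (by push_cast at hp; omega)⟩, h2⟩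
  choose φ hφ using hstep
  let x₀ : S 0 := ⟨0, fun p hp => (ha p (by push_cast at hp; omega)).eq_of_src _ _⟩
  let s (n : ℕ) : S n := Nat.rec x₀ φ n
  have hs (n k : ℕ) : ∀ p q (hpq : p + -1 = q), a - n - 1 < p →
      (s (n + k)).1.v p q hpq = (s n).1.v p q hpq := by
    induction k with
    | zero => intros; rfl
    | succ k ih =>
      intro p q hpq hp
      rw [← ih p q hpq hp]
      exact hφ (n + k) (s (n + k)) p q hpq (by push_cast; omega)
  have hs' (n m : ℕ) (hnm : n ≤ m) : ∀ p q (hpq : p + -1 = q), a - n - 1 < p →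
      (s m).1.v p q hpq = (s n).1.v p q hpq := by
    obtain ⟨k, rfl⟩ := Nat.exists_eq_add_of_le hnm
    exact hs n k
  let α : Cochain X C (-1) := Cochain.mk (fun p q hpq => (s (a - p).toNat).1.v p q hpq)
  have hαs (n : ℕ) : ∀ p q (hpq : p + -1 = q), a - n - 1 < p →
      α.v p q hpq = (s n).1.v p q hpq := by
    intro p q hpq hp
    exact (hs' (a - p).toNat n (by omega) p q hpq (by omega)).symm
  refine ⟨(Cochain.equivHomotopy _ _).symm ⟨α, ?_⟩⟩
  rw [Cochain.ofHom_zero, add_zero]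
  ext p
  rw [Cochain.ofHom_v]
  rw [← (s (a - p).toNat).2 p (by omega)]
  rw [δ_v (-1) 0 (neg_add_cancel 1) _ p p (add_zero _) (p - 1) (p + 1) (by omega) (by omega),
    δ_v (-1) 0 (neg_add_cancel 1) _ p p (add_zero _) (p - 1) (p + 1) (by omega) (by omega),
    hαs (a - p).toNat _ _ _ (by omega), hαs (a - p).toNat _ _ _ (by omega)]

/-- The vanishing of `Hom_K(X, cone(Y → I))`. -/
lemma hom_cone_eq_zero [HasExt.{w} 𝒜] (X Y I : CochainComplex 𝒜 ℤ) (i : Y ⟶ I) [QuasiIso i]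
    [∀ n, Injective (I.X n)] (a b : ℤ)
    (hX : ∀ n : ℤ, a ≤ n → IsZero (X.X n))
    (hY : ∀ n : ℤ, n ≤ b → IsZero (Y.X n))
    (hI : ∀ n : ℤ, n ≤ b → IsZero (I.X n))
    (hext : ∀ p q : ℤ, q < p → Subsingleton (Ext.{w} (X.X p) (Y.X q) (p - q).toNat))
    (f : (HomotopyCategory.quotient 𝒜 (ComplexShape.up ℤ)).obj X ⟶
      (HomotopyCategory.quotient 𝒜 (ComplexShape.up ℤ)).obj (mappingCone i)) : f = 0 := by
  obtain ⟨f, rfl⟩ := (HomotopyCategory.quotient _ _).map_surjective f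
  have hac : (mappingCone i).Acyclic := by
    rw [← HomotopyCategory.quotient_obj_mem_subcategoryAcyclic_iff_acyclic]
    have h := HomotopyCategory.mappingCone_triangleh_distinguished i
    refine (ObjectProperty.trW_iff_of_distinguished _ _ h).1 ?_
    rw [← HomotopyCategory.quasiIso_eq_trW_subcategoryAcyclic]
    exact (HomotopyCategory.quotient_map_mem_quasiIso_iff i).2
      ((HomologicalComplex.mem_quasiIso_iff _).2 inferInstance)
  have hz : ∀ n, n ≤ b - 1 → IsZero ((mappingCone i).X n) := by
    intro n hn
    rw [mappingCone.isZero_X_iff]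
    exact ⟨hY _ (by omega), hI _ (by omega)⟩
  obtain ⟨H⟩ := nullhomotopic X (mappingCone i) f a hX (fun p φ hφ => by
    refine lift_cocycle.{w} _ hac (b - 1) hz _ p ?_ φ hφ
    intro k hk
    refine subsingleton_of_forall_eq 0 (fun x => ?_)
    have h1 := hext p (p - k) (by omega)
    rw [show (p - (p - (k : ℤ))).toNat = k by omega] at h1
    obtain ⟨k, rfl⟩ : ∃ l, k = l + 1 := ⟨k - 1, by omega⟩
    have h2 := Ext.subsingleton_of_injective.{w} (X.X p) (I.X (p - 1 - (k + 1 : ℕ))) k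
    rw [← Ext.comp_mk₀_id x, ← mappingCone.id_X i _ (p - (k + 1 : ℕ)) (by omega), Ext.mk₀_add,
      Ext.comp_add, ← Ext.mk₀_comp_mk₀, ← Ext.mk₀_comp_mk₀,
      ← Ext.comp_assoc_of_second_deg_zero, ← Ext.comp_assoc_of_second_deg_zero,
      Subsingleton.elim (x.comp (Ext.mk₀ ((mappingCone.fst i).1.v _ _ _)) _) 0,
      Subsingleton.elim (x.comp (Ext.mk₀ ((mappingCone.snd i).v _ _ _)) _) 0,
      Ext.zero_comp, Ext.zero_comp, add_zero])
  rw [HomotopyCategory.eq_of_homotopy _ _ H, Functor.map_zero]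

section

variable {T : Type u} [Category.{v} T] [Preadditive T] [HasZeroObject T] [HasShift T ℤ]
  [∀ n : ℤ, (CategoryTheory.shiftFunctor T n).Additive] [Pretriangulated T]

lemma exact_two {A B C W : T} (u₁ : A ⟶ B) (v₁ : B ⟶ C) (w₁ : C ⟶ A⟦(1 : ℤ)⟧)
    (h : Triangle.mk u₁ v₁ w₁ ∈ distinguishedTriangles) (f : W ⟶ B) (hf : f ≫ v₁ = 0) :
    ∃ g : W ⟶ A, f = g ≫ u₁ :=
  Triangle.coyoneda_exact₂ _ h f hf

lemma eq_zero_of_comp {A B C W : T} (u₁ : A ⟶ B) (v₁ : B ⟶ C) (w₁ : C ⟶ A⟦(1 : ℤ)⟧)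
    (h : Triangle.mk u₁ v₁ w₁ ∈ distinguishedTriangles) (f : W ⟶ A) (hf : f ≫ u₁ = 0)
    (hz : ∀ g : W⟦(1 : ℤ)⟧ ⟶ C, g = 0) : f = 0 := by
  obtain ⟨g, hg⟩ : ∃ g : W⟦(1 : ℤ)⟧ ⟶ C, f⟦(1 : ℤ)⟧' = g ≫ w₁ :=
    Triangle.coyoneda_exact₁ _ h (f⟦(1 : ℤ)⟧')
      (show f⟦(1 : ℤ)⟧' ≫ u₁⟦(1 : ℤ)⟧' = 0 by rw [← Functor.map_comp, hf, Functor.map_zero])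
  apply (CategoryTheory.shiftFunctor T (1 : ℤ)).map_injective
  rw [hg, hz g, zero_comp, Functor.map_zero]

end

end Stmt10Aux

open Stmt10Aux

theorem stmt_10 {𝒜 : Type u} [Category.{v} 𝒜] [Abelian 𝒜] [EnoughInjectives 𝒜]
    [HasDerivedCategory.{w} 𝒜] [HasExt.{w} 𝒜]
    (X Y : CochainComplex 𝒜 ℤ)
    (hX : ∃ a : ℤ, ∀ n : ℤ, a ≤ n → IsZero (X.X n))
    (hY : ∃ b : ℤ, ∀ n : ℤ, n ≤ b → IsZero (Y.X n)) :
    ((∀ p q : ℤ, q < p → Subsingleton (Abelian.Ext (X.X p) (Y.X q) (p - q).toNat)) →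
      Function.Surjective fun (f : (HomotopyCategory.quotient 𝒜 (ComplexShape.up ℤ)).obj X ⟶
          (HomotopyCategory.quotient 𝒜 (ComplexShape.up ℤ)).obj Y) =>
        DerivedCategory.Qh.map f) ∧
    ((∀ p q : ℤ, q + 1 < p → Subsingleton (Abelian.Ext (X.X p) (Y.X q) (p - q - 1).toNat)) →
      Function.Injective fun (f : (HomotopyCategory.quotient 𝒜 (ComplexShape.up ℤ)).obj X ⟶
          (HomotopyCategory.quotient 𝒜 (ComplexShape.up ℤ)).obj Y) =>
        DerivedCategory.Qh.map f) := by
  obtain ⟨a, ha⟩ := hX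
  obtain ⟨b, hb⟩ := hY
  have : Y.IsStrictlyGE (b + 1) := by
    rw [CochainComplex.isStrictlyGE_iff]
    exact fun i hi => hb i (by omega)
  obtain ⟨I, i, _, _, _⟩ := CochainComplex.Plus.modelCategoryQuillen.exists_quasiIso_injective Y (b + 1)
  have hI : ∀ n : ℤ, n ≤ b → IsZero (I.X n) := fun n hn =>
    I.isZero_of_isStrictlyGE (b + 1) n (by omega)
  have := CochainComplex.isKInjective_of_injective I (b + 1)
  obtain ⟨m₂, m₃, hT⟩ : ∃ (m₂ : (HomotopyCategory.quotient 𝒜 (ComplexShape.up ℤ)).obj I ⟶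
      (HomotopyCategory.quotient 𝒜 (ComplexShape.up ℤ)).obj (CochainComplex.mappingCone i))
      (m₃ : (HomotopyCategory.quotient 𝒜 (ComplexShape.up ℤ)).obj (CochainComplex.mappingCone i) ⟶
        ((HomotopyCategory.quotient 𝒜 (ComplexShape.up ℤ)).obj Y)⟦(1 : ℤ)⟧),
      Pretriangulated.Triangle.mk ((HomotopyCategory.quotient 𝒜 (ComplexShape.up ℤ)).map i) m₂ m₃ ∈
        Pretriangulated.distinguishedTriangles :=
    ⟨_, _, HomotopyCategory.mappingCone_triangleh_distinguished i⟩
  have hiso : IsIso (DerivedCategory.Qh.map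
      ((HomotopyCategory.quotient 𝒜 (ComplexShape.up ℤ)).map i)) :=
    Localization.inverts DerivedCategory.Qh (HomotopyCategory.quasiIso 𝒜 (ComplexShape.up ℤ)) _
      ((HomotopyCategory.quotient_map_mem_quasiIso_iff i).2
        ((HomologicalComplex.mem_quasiIso_iff _).2 inferInstance))
  have hbij (K : HomotopyCategory 𝒜 (ComplexShape.up ℤ)) :=
    CochainComplex.IsKInjective.Qh_map_bijective K I
  constructor
  · intro hext g
    obtain ⟨g', hg'⟩ := (hbij _).2 (g ≫ DerivedCategory.Qh.map
      ((HomotopyCategory.quotient 𝒜 (ComplexShape.up ℤ)).map i))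
    obtain ⟨f, hf⟩ := exact_two _ _ _ hT g'
      (hom_cone_eq_zero X Y I i a b ha hb hI hext _)
    refine ⟨f, ?_⟩
    dsimp
    rw [← cancel_mono (DerivedCategory.Qh.map
      ((HomotopyCategory.quotient 𝒜 (ComplexShape.up ℤ)).map i)), ← hg', hf, Functor.map_comp]
  · intro hext f₁ f₂ hf
    dsimp at hf
    rw [← sub_eq_zero]
    have h0 : (f₁ - f₂) ≫ (HomotopyCategory.quotient 𝒜 (ComplexShape.up ℤ)).map i = 0 := by
      apply (hbij _).1
      simp [hf]
    refine eq_zero_of_comp _ _ _ hT _ h0 (fun g => ?_)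
    have hg0 : ((HomotopyCategory.quotient 𝒜 (ComplexShape.up ℤ)).commShiftIso (1 : ℤ)).hom.app X
        ≫ g = 0 := by
      refine hom_cone_eq_zero (X⟦(1 : ℤ)⟧) Y I i (a - 1) b (fun n hn => ha (n + 1) (by omega))
        hb hI (fun p q hpq => ?_) _
      have := hext (p + 1) q (by omega)
      rw [show p + 1 - q - 1 = p - q by ring] at this
      exact this
    exact (cancel_epi (((HomotopyCategory.quotient 𝒜 (ComplexShape.up ℤ)).commShiftIso
        (1 : ℤ)).hom.app X)).1 (hg0.trans comp_zero.symm)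
end
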